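/- arXiv:1606.01056 — 10 statements merged into one kernel-verified Lean document; each statement's English description precedes it below -/
import Mathlib

section
/- For every natural number n, the polynomial p_n obtained by differentiating the polynomial (X^2 - 1)^n exactly n times (the unnormalised Legendre polynomial of Rodrigues' formula) satisfies the Legendre differential equation: the derivative of the polynomial (1 - X^2) * (derivative of p_n) equals -n*(n+1) * p_n. -/
open Polynomial

theorem X_sq_sub_one_mul_derivative_pow {R : Type*} [CommRing R] (n : ℕ) :
    (X ^ 2 - 1) * derivative ((X ^ 2 - 1 : R[X]) ^ n)
      = 2 * (n : R[X]) * X * (X ^ 2 - 1) ^ n := by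
  cases n with
  | zero => simp
  | succ m =>
    simp [derivative_pow_succ]
    ring

/-- The differential equation satisfied by the `k`-th derivative of `(X ^ 2 - 1) ^ n`. -/
theorem iterate_derivative_X_sq_sub_one_pow_ode {R : Type*} [CommRing R] (n k : ℕ) :
    (X ^ 2 - 1) * derivative^[k + 2] ((X ^ 2 - 1 : R[X]) ^ n)
      + 2 * ((k : R[X]) + 1 - (n : R[X])) * X * derivative^[k + 1] ((X ^ 2 - 1) ^ n)
      + ((k : R[X]) + 1) * ((k : R[X]) - 2 * (n : R[X])) * derivative^[k] ((X ^ 2 - 1) ^ n) = 0 := by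
  induction k with
  | zero =>
    have h := congrArg derivative (X_sq_sub_one_mul_derivative_pow (R := R) n)
    simp only [Function.iterate_succ_apply', Function.iterate_zero_apply]
    generalize (X ^ 2 - 1 : R[X]) ^ n = u at h ⊢
    simp at h ⊢
    linear_combination h
  | succ k ih =>
    have h := congrArg derivative ih
    simp only [Function.iterate_succ_apply'] at h ⊢
    generalize derivative^[k] ((X ^ 2 - 1 : R[X]) ^ n) = u at h ⊢
    simp at h ⊢
    linear_combination h

/-- The unnormalised Legendre polynomial `p_n = derivative^[n] ((X^2 - 1)^n)`
satisfies the Legendre differential equation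
`((1 - X^2) * p_n')' = -n(n+1) * p_n`. -/
theorem legendre_sturm_liouville (n : ℕ) :
    derivative ((1 - X ^ 2) * derivative
        ((derivative (R := ℝ))^[n] ((X ^ 2 - 1) ^ n)))
      = C (-(n * (n + 1) : ℝ)) * (derivative (R := ℝ))^[n] ((X ^ 2 - 1) ^ n) := by
  have h := iterate_derivative_X_sq_sub_one_pow_ode (R := ℝ) n n
  simp only [Function.iterate_succ_apply'] at h
  generalize derivative^[n] ((X ^ 2 - 1 : ℝ[X]) ^ n) = p at h ⊢
  simp
  linear_combination -h
end

section
/- Let p be a natural number, let c : Fin (p+1) → ℝ be nonnegative, and let μ : Fin (p+1) → ℝ satisfy μ 0 = 0 and μ n > 0 for all n ≠ 0. Let T be a real number with c 0 < T ≤ ∑ₙ c n. Then there exists ε ≥ 0 such that ∑ₙ exp (-2 ε (μ n)) * (c n) = T. In other words, the filter condition of the operator-splitting lemma can be fulfilled by a suitable filter strength whenever the target energy lies strictly above the energy of the constant mode and at most at the unfiltered energy. -/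
open Finset

/-- As the filter strength grows, only the energy of the constant mode survives. -/
theorem tendsto_filtered_energy_atTop (p : ℕ) (c μ : Fin (p + 1) → ℝ)
    (hμ0 : μ 0 = 0) (hμ : ∀ n, n ≠ 0 → 0 < μ n) :
    Filter.Tendsto (fun ε : ℝ => ∑ n, Real.exp (-2 * ε * μ n) * c n)
      Filter.atTop (nhds (c 0)) := by
  have hmode (i : Fin p) : Filter.Tendsto
      (fun ε : ℝ => Real.exp (-2 * ε * μ i.succ) * c i.succ) Filter.atTop (nhds 0) := by
    have hpos : 0 < 2 * μ i.succ := mul_pos two_pos (hμ _ (Fin.succ_ne_zero i))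
    have hexp := (Real.tendsto_exp_neg_atTop_nhds_zero.comp
      (Filter.tendsto_id.const_mul_atTop hpos)).mul_const (c i.succ)
    rw [zero_mul] at hexp
    refine hexp.congr fun ε => ?_
    simp only [Function.comp_apply, id_eq]
    ring_nf
  simp only [Fin.sum_univ_succ, hμ0, mul_zero, Real.exp_zero, one_mul]
  simpa using (tendsto_finsetSum univ fun i _ => hmode i).const_add (c 0)

/-- The filter condition of the operator-splitting lemma can be fulfilled by a
suitable filter strength `ε ≥ 0` whenever the target energy `T` lies strictly
above the energy of the constant mode and at most at the unfiltered energy. -/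
theorem exists_filter_strength (p : ℕ) (c μ : Fin (p + 1) → ℝ)
    (hc : ∀ n, 0 ≤ c n) (hμ0 : μ 0 = 0) (hμ : ∀ n, n ≠ 0 → 0 < μ n)
    (T : ℝ) (hT₁ : c 0 < T) (hT₂ : T ≤ ∑ n, c n) :
    ∃ ε : ℝ, 0 ≤ ε ∧ ∑ n, Real.exp (-2 * ε * μ n) * c n = T := by
  have hcont : Continuous fun ε : ℝ => ∑ n, Real.exp (-2 * ε * μ n) * c n := by fun_prop
  obtain ⟨M, hMT, hM⟩ := (((tendsto_filtered_energy_atTop p c μ hμ0 hμ).eventually_lt_const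
    hT₁).and (Filter.eventually_ge_atTop 0)).exists
  obtain ⟨ε, hε, hεT⟩ := intermediate_value_Icc' hM hcont.continuousOn
    ⟨hMT.le, by simpa using hT₂⟩
  exact ⟨ε, hε.1, hεT⟩
end

section
/- Let N be a natural number, ε ≥ 0 a real number, and let μ, c : Fin N → ℝ be nonnegative functions. Let T be a real number. If ∑ₙ exp (-2 ε (μ n)) * (c n) ≤ T and ∑ₙ 2 (μ n) (c n) > 0, then ε ≥ (∑ₙ c n − T) / (∑ₙ 2 (μ n) (c n)). -/
open Finset

/-- Necessary lower bound on the adaptive filter strength (Lemma 4 of the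
paper). -/
theorem filter_strength_lower_bound (N : ℕ) (ε : ℝ) (hε : 0 ≤ ε)
    (μ c : Fin N → ℝ) (hμ : ∀ n, 0 ≤ μ n) (hc : ∀ n, 0 ≤ c n) (T : ℝ)
    (hfilter : ∑ n, Real.exp (-2 * ε * μ n) * c n ≤ T)
    (hpos : 0 < ∑ n, 2 * μ n * c n) :
    ε ≥ (∑ n, c n - T) / (∑ n, 2 * μ n * c n) := by
  rw [ge_iff_le, div_le_iff₀ hpos, sub_le_iff_le_add']
  calc ∑ n, c n
      ≤ ∑ n, (Real.exp (-2 * ε * μ n) * c n + ε * (2 * μ n * c n)) := by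
        refine Finset.sum_le_sum fun n _ => ?_
        nlinarith [mul_le_mul_of_nonneg_right (Real.add_one_le_exp (-2 * ε * μ n)) (hc n)]
    _ = ∑ n, Real.exp (-2 * ε * μ n) * c n + ε * ∑ n, 2 * μ n * c n := by
        rw [Finset.sum_add_distrib, Finset.mul_sum]
    _ ≤ T + ε * ∑ n, 2 * μ n * c n := by gcongr
end

section
/- Let M be a real symmetric positive definite n×n matrix and let F be an invertible real n×n matrix with M F = Fᵀ M. Let u : ℝ → ℝ^n be differentiable and g : ℝ → ℝ^n with u'(t) = F (g t) for all t (the filtered semidiscretisation). Then for every t, the function t ↦ (u t)ᵀ (M F⁻¹) (u t) is differentiable with derivative 2 (u t)ᵀ M (g t). In particular, the rate of change of the norm induced by M F⁻¹ equals the energy rate uᵀ M g of the unfiltered semidiscretisation. -/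
open Matrix

namespace HasDerivAt

variable {m n : Type*} [Fintype n]

theorem dotProduct {v w : ℝ → n → ℝ} {v' w' : n → ℝ} {t : ℝ}
    (hv : HasDerivAt v v' t) (hw : HasDerivAt w w' t) :
    HasDerivAt (fun s => v s ⬝ᵥ w s) (v' ⬝ᵥ w t + v t ⬝ᵥ w') t := by
  simp only [_root_.dotProduct, ← Finset.sum_add_distrib]
  exact HasDerivAt.fun_sum fun i _ => (hasDerivAt_pi.1 hv i).mul (hasDerivAt_pi.1 hw i)

theorem const_mulVec [Fintype m] (A : Matrix m n ℝ) {v : ℝ → n → ℝ} {v' : n → ℝ} {t : ℝ}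
    (hv : HasDerivAt v v' t) : HasDerivAt (fun s => A *ᵥ v s) (A *ᵥ v') t :=
  (Matrix.mulVecLin A).toContinuousLinearMap.hasFDerivAt.comp_hasDerivAt t hv

/-- The derivative of the quadratic form of a symmetric matrix along a curve. -/
theorem dotProduct_mulVec_self {A : Matrix n n ℝ} (hA : A.IsSymm) {v : ℝ → n → ℝ}
    {v' : n → ℝ} {t : ℝ} (hv : HasDerivAt v v' t) :
    HasDerivAt (fun s => v s ⬝ᵥ A *ᵥ v s) (2 * (v t ⬝ᵥ A *ᵥ v')) t := by
  have hsymm : v' ⬝ᵥ A *ᵥ v t = v t ⬝ᵥ A *ᵥ v' := by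
    rw [Matrix.dotProduct_mulVec, ← Matrix.mulVec_transpose, hA.eq, dotProduct_comm]
  simpa only [hsymm, two_mul] using hv.dotProduct (hv.const_mulVec A)

end HasDerivAt

/-- If `F` is invertible and self-adjoint for the symmetric form `M`, then `M * F⁻¹` is
symmetric. -/
theorem Matrix.IsSymm.mul_inv_of_selfAdjoint {n R : Type*} [Fintype n] [DecidableEq n]
    [CommRing R] {M F : Matrix n n R} (hM : M.IsSymm) (hF : IsUnit F.det)
    (hMF : M * F = Fᵀ * M) : (M * F⁻¹).IsSymm := by
  have hFt : IsUnit Fᵀ.det := by rwa [det_transpose]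
  calc (M * F⁻¹)ᵀ = Fᵀ⁻¹ * (M * F) * F⁻¹ := by
        rw [transpose_mul, hM.eq, transpose_nonsing_inv, ← Matrix.mul_assoc,
          mul_nonsing_inv_cancel_right F _ hF]
    _ = M * F⁻¹ := by rw [hMF, nonsing_inv_mul_cancel_left Fᵀ _ hFt]

/-- Stability of the filtered-derivative semidiscretisation in the norm induced
by `M F⁻¹` (Lemma 5 of the paper): the rate of change of the `M F⁻¹`-energy of
the filtered scheme equals the energy rate `2 uᵀ M g` of the unfiltered one. -/
theorem filtered_derivative_energy_rate {n : ℕ} (M F : Matrix (Fin n) (Fin n) ℝ)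
    (hM : M.PosDef) (hF : IsUnit F.det) (hMF : M * F = Fᵀ * M)
    (u g : ℝ → Fin n → ℝ) (hu : Differentiable ℝ u)
    (hode : ∀ t, deriv u t = F *ᵥ g t) (t : ℝ) :
    HasDerivAt (fun t => u t ⬝ᵥ (M * F⁻¹) *ᵥ u t)
      (2 * (u t ⬝ᵥ M *ᵥ g t)) t := by
  have hsymm : M.IsSymm := by simpa using hM.isHermitian
  have hderiv : HasDerivAt u (F *ᵥ g t) t := hode t ▸ (hu t).hasDerivAt
  simpa [mulVec_mulVec, nonsing_inv_mul_cancel_right F M hF] using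
    hderiv.dotProduct_mulVec_self (hsymm.mul_inv_of_selfAdjoint hF hMF)
end

section
/- Let M be a real symmetric n×n matrix and let S be a real n×n matrix with M S = Sᵀ M; set F := S², and assume F is invertible. Then for all u, g ∈ ℝ^n and all real Δt: (u + Δt • F g)ᵀ (M F⁻¹) (u + Δt • F g) = uᵀ (M F⁻¹) u + 2 Δt (uᵀ M g) + Δt² (S g)ᵀ M (S g). That is, an explicit Euler step with filtered time derivative changes the M F⁻¹-energy by the unfiltered energy rate 2Δt uᵀ M g plus the reduced increment Δt² ‖F^{1/2} g‖²_M. -/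
open Matrix

/-- Moving a matrix from the left to the right of a dot product transposes it. -/
theorem mulVec_dotProduct_eq_dotProduct_transpose_mulVec {m n R : Type*} [Fintype m] [Fintype n]
    [CommSemiring R] (B : Matrix m n R) (v : n → R) (w : m → R) :
    (B *ᵥ v) ⬝ᵥ w = v ⬝ᵥ Bᵀ *ᵥ w := by
  rw [dotProduct_mulVec, vecMul_transpose]

/-- An explicit Euler step with filtered time derivative changes the
`M F⁻¹`-energy by the unfiltered energy rate `2 Δt uᵀ M g` plus the reduced
increment `Δt² ‖F^{1/2} g‖²_M`, where `S = F^{1/2}` is an `M`-self-adjoint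
square root of the filter `F`. -/
theorem filtered_euler_energy_identity {n : ℕ} (M S : Matrix (Fin n) (Fin n) ℝ)
    (hM : Mᵀ = M) (hMS : M * S = Sᵀ * M) (hS : IsUnit (S ^ 2).det)
    (u g : Fin n → ℝ) (Δt : ℝ) :
    (u + Δt • (S ^ 2) *ᵥ g) ⬝ᵥ (M * (S ^ 2)⁻¹) *ᵥ (u + Δt • (S ^ 2) *ᵥ g)
      = u ⬝ᵥ (M * (S ^ 2)⁻¹) *ᵥ u + 2 * Δt * (u ⬝ᵥ M *ᵥ g)
        + Δt ^ 2 * ((S *ᵥ g) ⬝ᵥ M *ᵥ (S *ᵥ g)) := by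
  have hMF : M * S ^ 2 = (S ^ 2)ᵀ * M := by
    rw [transpose_pow, pow_two, pow_two, ← mul_assoc, hMS, mul_assoc, hMS, ← mul_assoc]
  have hSMS : (S ^ 2)ᵀ * M = Sᵀ * (M * S) := by
    rw [hMS, transpose_pow, pow_two, mul_assoc]
  have hAF : M * (S ^ 2)⁻¹ * S ^ 2 = M := nonsing_inv_mul_cancel_right _ M hS
  have hFA : (S ^ 2)ᵀ * (M * (S ^ 2)⁻¹) = M := by
    rw [← mul_assoc, ← hMF, mul_nonsing_inv_cancel_right _ M hS]
  have huF : u ⬝ᵥ (M * (S ^ 2)⁻¹) *ᵥ (S ^ 2) *ᵥ g = u ⬝ᵥ M *ᵥ g := by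
    rw [mulVec_mulVec, hAF]
  have hFu : ((S ^ 2) *ᵥ g) ⬝ᵥ (M * (S ^ 2)⁻¹) *ᵥ u = u ⬝ᵥ M *ᵥ g := by
    rw [mulVec_dotProduct_eq_dotProduct_transpose_mulVec, mulVec_mulVec, hFA, dotProduct_comm,
      mulVec_dotProduct_eq_dotProduct_transpose_mulVec, hM]
  have hFF : ((S ^ 2) *ᵥ g) ⬝ᵥ (M * (S ^ 2)⁻¹) *ᵥ (S ^ 2) *ᵥ g
      = (S *ᵥ g) ⬝ᵥ M *ᵥ (S *ᵥ g) := by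
    simp only [mulVec_dotProduct_eq_dotProduct_transpose_mulVec, mulVec_mulVec, hAF, hSMS]
  simp only [mulVec_add, mulVec_smul, add_dotProduct, dotProduct_add, smul_dotProduct,
    dotProduct_smul, smul_eq_mul, huF, hFu, hFF]
  ring
end

section
/- Let M, D, R, B be real matrices (M an invertible symmetric n×n matrix, D an n×n matrix, R a b×n matrix, B a b×b matrix) satisfying the SBP property M D + Dᵀ M = Rᵀ B R. For u ∈ ℝ^n and f ∈ ℝ^b define g := -D u - M⁻¹ Rᵀ B (f - R u) (the CPR/SBP semidiscretisation of linear advection with numerical flux values f). Then uᵀ M g = (1/2) (R u)ᵀ B (R u) - (R u)ᵀ B f. -/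
open Matrix

/-- Per-element energy rate of the CPR/SBP semidiscretisation of linear
advection: `uᵀ M g = ½ (Ru)ᵀ B (Ru) − (Ru)ᵀ B f`. -/
theorem sbp_cpr_energy_rate {n b : ℕ} (M D : Matrix (Fin n) (Fin n) ℝ)
    (R : Matrix (Fin b) (Fin n) ℝ) (B : Matrix (Fin b) (Fin b) ℝ)
    (hM : Mᵀ = M) (hMinv : IsUnit M.det)
    (hSBP : M * D + Dᵀ * M = Rᵀ * B * R)
    (u : Fin n → ℝ) (f : Fin b → ℝ) :
    u ⬝ᵥ M *ᵥ (-(D *ᵥ u) - M⁻¹ *ᵥ (Rᵀ *ᵥ (B *ᵥ (f - R *ᵥ u))))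
      = (1 / 2) * ((R *ᵥ u) ⬝ᵥ B *ᵥ (R *ᵥ u)) - (R *ᵥ u) ⬝ᵥ B *ᵥ f := by
  have boundary (v : Fin b → ℝ) : u ⬝ᵥ Rᵀ *ᵥ v = (R *ᵥ u) ⬝ᵥ v := by
    rw [dotProduct_mulVec, vecMul_transpose]
  have transpose_eq : u ⬝ᵥ (Dᵀ * M) *ᵥ u = u ⬝ᵥ (M * D) *ᵥ u := by
    have h : (Dᵀ * M) = (M * D)ᵀ := by rw [transpose_mul, hM]
    rw [h, mulVec_transpose, dotProduct_comm, dotProduct_mulVec]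
  have energy : 2 * (u ⬝ᵥ (M * D) *ᵥ u) = (R *ᵥ u) ⬝ᵥ B *ᵥ (R *ᵥ u) := by
    have h := congrArg (fun A => u ⬝ᵥ A *ᵥ u) hSBP
    simp only [add_mulVec, dotProduct_add, transpose_eq] at h
    rw [← mulVec_mulVec u (Rᵀ * B), ← mulVec_mulVec _ Rᵀ, boundary] at h
    rw [← h, two_mul]
  have cancel (v : Fin n → ℝ) : M *ᵥ (M⁻¹ *ᵥ v) = v := by
    rw [mulVec_mulVec, mul_nonsing_inv _ hMinv, one_mulVec]
  rw [mulVec_sub, cancel, mulVec_neg, mulVec_mulVec, dotProduct_sub, dotProduct_neg,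
    boundary, mulVec_sub, dotProduct_sub]
  linarith
end

section
/- Let M, D, R, B be real matrices (M an invertible symmetric n×n matrix, D an n×n matrix, R a b×n matrix, B a b×b matrix) satisfying the SBP property M D + Dᵀ M = Rᵀ B R, and assume D 𝟙ₙ = 0 and R 𝟙ₙ = 𝟙_b (constants are differentiated to zero and restricted to constants). For u ∈ ℝ^n and f ∈ ℝ^b define g := -D u - M⁻¹ Rᵀ B (f - R u). Then 𝟙ₙᵀ M g = -𝟙_bᵀ B f; i.e. the rate of change of the total amount of u in the element equals minus the boundary integral of the numerical flux, so the scheme is conservative across elements. -/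
open Matrix

/-- Conservation across elements of the CPR/SBP semidiscretisation of linear
advection: the rate of change of the total amount of `u` in the element equals
minus the boundary integral of the numerical flux. -/
theorem sbp_cpr_conservative {n b : ℕ} (M D : Matrix (Fin n) (Fin n) ℝ)
    (R : Matrix (Fin b) (Fin n) ℝ) (B : Matrix (Fin b) (Fin b) ℝ)
    (hM : Mᵀ = M) (hMinv : IsUnit M.det)
    (hSBP : M * D + Dᵀ * M = Rᵀ * B * R)
    (hD1 : D *ᵥ (1 : Fin n → ℝ) = 0) (hR1 : R *ᵥ (1 : Fin n → ℝ) = 1)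
    (u : Fin n → ℝ) (f : Fin b → ℝ) :
    (1 : Fin n → ℝ) ⬝ᵥ M *ᵥ (-(D *ᵥ u) - M⁻¹ *ᵥ (Rᵀ *ᵥ (B *ᵥ (f - R *ᵥ u))))
      = -((1 : Fin b → ℝ) ⬝ᵥ B *ᵥ f) := by
  have h_restrict (v : Fin b → ℝ) : (1 : Fin n → ℝ) ⬝ᵥ Rᵀ *ᵥ v = (1 : Fin b → ℝ) ⬝ᵥ v := by
    rw [dotProduct_mulVec, vecMul_transpose, hR1]
  have h_deriv (v : Fin n → ℝ) : (1 : Fin n → ℝ) ⬝ᵥ Dᵀ *ᵥ v = 0 := by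
    rw [dotProduct_mulVec, vecMul_transpose, hD1, zero_dotProduct]
  have h_sbp : (1 : Fin n → ℝ) ⬝ᵥ M *ᵥ (D *ᵥ u) = (1 : Fin b → ℝ) ⬝ᵥ B *ᵥ (R *ᵥ u) := by
    have h := congrArg (fun A => (1 : Fin n → ℝ) ⬝ᵥ A *ᵥ u) hSBP
    simpa only [add_mulVec, dotProduct_add, ← mulVec_mulVec, h_deriv, h_restrict,
      add_zero] using h
  have h_inv (v : Fin n → ℝ) : M *ᵥ (M⁻¹ *ᵥ v) = v := by
    rw [mulVec_mulVec, mul_nonsing_inv _ hMinv, one_mulVec]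
  rw [mulVec_sub, mulVec_neg, h_inv, dotProduct_sub, dotProduct_neg, h_sbp, h_restrict,
    mulVec_sub, dotProduct_sub]
  ring
end

section
/- Let M, D, A be real n×n matrices with M invertible, and suppose D 𝟙 = 0 (the discrete derivative annihilates constants). Then for every natural number s ≥ 1 and every u ∈ ℝ^n, 𝟙ᵀ M ((M⁻¹ Dᵀ M A D)^s u) = 0. Hence adding the discrete artificial dissipation term -ε (M⁻¹ Dᵀ M A D)^s u to a semidiscretisation does not change the rate of change of the integral of the solution over the element: conservation is preserved. -/
open Matrix

/-- The discrete artificial dissipation term `-ε (M⁻¹ Dᵀ M A D)^s u` does not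
change the rate of change of the integral of the solution over the element:
conservation is preserved. -/
theorem discrete_dissipation_conservative {n : ℕ}
    (M D A : Matrix (Fin n) (Fin n) ℝ) (hMinv : IsUnit M.det)
    (hD1 : D *ᵥ (1 : Fin n → ℝ) = 0) (s : ℕ) (hs : 1 ≤ s) (u : Fin n → ℝ) :
    (1 : Fin n → ℝ) ⬝ᵥ M *ᵥ ((M⁻¹ * Dᵀ * M * A * D) ^ s *ᵥ u) = 0 := by
  obtain ⟨k, rfl⟩ := Nat.exists_eq_add_of_le' hs
  have h : M * (M⁻¹ * Dᵀ * M * A * D) ^ (k + 1) =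
      Dᵀ * (M * A * D * (M⁻¹ * Dᵀ * M * A * D) ^ k) := by
    simp only [pow_succ', Matrix.mul_assoc, mul_nonsing_inv_cancel_left M _ hMinv]
  rw [mulVec_mulVec, h, ← mulVec_mulVec, dotProduct_mulVec, vecMul_transpose, hD1,
    zero_dotProduct]
end

section
/- Let M, D, A be real n×n matrices with M symmetric positive definite, M invertible, and with M A symmetric positive semidefinite. Set L := M⁻¹ Dᵀ M A D. Then for every natural number s ≥ 1 and every u ∈ ℝ^n, uᵀ M (L^s u) ≥ 0. Consequently, for every ε ≥ 0 the discrete artificial dissipation term g := -ε L^s u satisfies uᵀ M g ≤ 0, i.e. it dissipates the discrete energy ‖u‖²_M in the semidiscretisation. -/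
open Matrix

/-- If `M` and `M * L` are positive semidefinite, then so is `M * L ^ s` for every `s`. -/
theorem Matrix.PosSemidef.mul_pow {n R : Type*} [Fintype n] [DecidableEq n] [CommRing R]
    [PartialOrder R] [StarRing R] {M L : Matrix n n R} (hM : M.PosSemidef)
    (hML : (M * L).PosSemidef) (s : ℕ) : (M * L ^ s).PosSemidef := by
  induction s using Nat.twoStepInduction with
  | zero => simpa using hM
  | one => simpa using hML
  | more s ih _ =>
    have hadj : M * L = Lᴴ * M := by
      rw [← hML.isHermitian.eq, conjTranspose_mul, hM.isHermitian.eq]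
    have hpow : M * L ^ (s + 2) = Lᴴ * (M * L ^ s) * L := by
      rw [← Matrix.mul_assoc Lᴴ, ← hadj, pow_succ, pow_succ']
      simp only [Matrix.mul_assoc]
    rw [hpow]
    exact ih.conjTranspose_mul_mul_same L

/-- The discrete artificial dissipation term `-ε (M⁻¹ Dᵀ M A D)^s u` dissipates
the discrete energy `‖u‖²_M` of the semidiscretisation. -/
theorem discrete_dissipation_dissipative {n : ℕ}
    (M D A : Matrix (Fin n) (Fin n) ℝ) (hM : M.PosDef)
    (hMA : (M * A).PosSemidef) (s : ℕ) (hs : 1 ≤ s) (u : Fin n → ℝ) :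
    0 ≤ u ⬝ᵥ M *ᵥ ((M⁻¹ * Dᵀ * M * A * D) ^ s *ᵥ u) ∧
      ∀ ε : ℝ, 0 ≤ ε →
        u ⬝ᵥ M *ᵥ (-(ε • ((M⁻¹ * Dᵀ * M * A * D) ^ s *ᵥ u))) ≤ 0 := by
  have hML : (M * (M⁻¹ * Dᵀ * M * A * D)).PosSemidef := by
    have hdet : IsUnit M.det := (Matrix.isUnit_iff_isUnit_det M).mp hM.isUnit
    have h := hMA.conjTranspose_mul_mul_same D
    rw [conjTranspose_eq_transpose_of_trivial] at h
    simpa only [Matrix.mul_assoc, mul_nonsing_inv_cancel_left _ _ hdet] using h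
  have hnonneg : 0 ≤ u ⬝ᵥ M *ᵥ ((M⁻¹ * Dᵀ * M * A * D) ^ s *ᵥ u) := by
    simpa [mulVec_mulVec] using
      (hM.posSemidef.mul_pow hML s).dotProduct_mulVec_nonneg u
  refine ⟨hnonneg, fun ε hε => ?_⟩
  rw [mulVec_neg, mulVec_smul, dotProduct_neg, dotProduct_smul, smul_eq_mul, neg_nonpos]
  exact mul_nonneg hε hnonneg
end

section
/- Let M, D, R, B be real matrices (M a symmetric n×n matrix, D an n×n matrix, R a b×n matrix, B a b×b matrix) satisfying the SBP property M D + Dᵀ M = Rᵀ B R, and let U be an n×n matrix with M U = Uᵀ M (the multiplication operator U is self-adjoint with respect to M). Then for every u ∈ ℝ^n, uᵀ M (D (U u)) + uᵀ M (U (D u)) = (R u)ᵀ B (R (U u)). That is, the volume terms of the skew-symmetric discretisation of Burgers' equation reduce to a pure boundary term, which is the key identity in the energy-stability proof of the skew-symmetric CPR/SBP scheme. -/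
open Matrix

/-- Key identity in the energy-stability proof of the skew-symmetric CPR/SBP
scheme for Burgers' equation: the volume terms reduce to a pure boundary
term. -/
theorem skew_symmetric_volume_terms {n b : ℕ} (M D : Matrix (Fin n) (Fin n) ℝ)
    (R : Matrix (Fin b) (Fin n) ℝ) (B : Matrix (Fin b) (Fin b) ℝ)
    (hM : Mᵀ = M) (hSBP : M * D + Dᵀ * M = Rᵀ * B * R)
    (U : Matrix (Fin n) (Fin n) ℝ) (hU : M * U = Uᵀ * M) (u : Fin n → ℝ) :
    u ⬝ᵥ M *ᵥ (D *ᵥ (U *ᵥ u)) + u ⬝ᵥ M *ᵥ (U *ᵥ (D *ᵥ u))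
      = (R *ᵥ u) ⬝ᵥ B *ᵥ (R *ᵥ (U *ᵥ u)) := by
  have h_transpose : M * U * D = (Dᵀ * M * U)ᵀ := by
    rw [transpose_mul, transpose_mul, transpose_transpose, hM, hU, Matrix.mul_assoc]
  have h_swap : u ⬝ᵥ M *ᵥ (U *ᵥ (D *ᵥ u)) = u ⬝ᵥ (Dᵀ * M) *ᵥ (U *ᵥ u) := by
    rw [mulVec_mulVec, mulVec_mulVec, h_transpose, mulVec_mulVec,
      mulVec_transpose, dotProduct_comm, ← dotProduct_mulVec]
  rw [h_swap, mulVec_mulVec, ← dotProduct_add, ← add_mulVec, hSBP, ← mulVec_mulVec,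
    ← mulVec_mulVec, dotProduct_mulVec, vecMul_transpose]
end
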